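/- For each $k$-element subset $I \subseteq \{1,\dots,n\}$, the orthogonal projection $v_I = \pi(V_I)$ expanded in the basis $\{V_J : |J|=k\}$ is $v_I = \sum_{J} a_{|I \cap J|}\, V_J$, where the sum is over all $k$-element subsets $J \subseteq \{1,\dots,n\}$ and $a_\ell = (-1)^{k+\ell}\,(n-2k+1)\,(k-\ell)!\,(n-2k+\ell)!/(n-k+1)!$ for $\ell = 0,\dots,k$. -/

import Mathlib

noncomputable section

/-- The `sl₂`-module `W^{⊗n}`, `W = ℂ²`, identified with the free complex vector space
on the set of subsets of `{1,…,n}`. -/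
abbrev WT (n : ℕ) := Finset (Fin n) →₀ ℂ

/-- Build a linear operator on `WT n` from its values on the basis vectors `V_I`. -/
def mkOp {n : ℕ} (φ : Finset (Fin n) → WT n) : WT n →ₗ[ℂ] WT n :=
  Finsupp.lsum ℂ fun I => LinearMap.toSpanSingleton ℂ (WT n) (φ I)

/-- Diagonal action of `e`: `e V_I = ∑_{i ∈ I} V_{I∖{i}}`. -/
def opE (n : ℕ) : WT n →ₗ[ℂ] WT n :=
  mkOp fun I => ∑ i ∈ I, Finsupp.single (I.erase i) 1

/-- Diagonal action of `f`: `f V_I = ∑_{i ∉ I} V_{I∪{i}}`. -/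
def opF (n : ℕ) : WT n →ₗ[ℂ] WT n :=
  mkOp fun I => ∑ i ∈ Iᶜ, Finsupp.single (insert i I) 1

/-- Diagonal action of `h`: `h V_I = (n - 2|I|) V_I`. -/
def opH (n : ℕ) : WT n →ₗ[ℂ] WT n :=
  mkOp fun I => ((n : ℂ) - 2 * I.card) • Finsupp.single I 1

/-- The Shapovalov form: the symmetric bilinear form with `(V_I, V_J) = δ_{IJ}`. -/
def shap {n : ℕ} (x y : WT n) : ℂ := x.sum fun I c => c * y I

/-- The weight space `W^{⊗n}[n-2k]`, spanned by the `V_I` with `|I| = k`. -/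
def weight (n k : ℕ) : Submodule ℂ (WT n) :=
  Submodule.span ℂ {x | ∃ I : Finset (Fin n), I.card = k ∧ x = Finsupp.single I 1}

/-- The space of singular vectors `Sing W^{⊗n}[n-2k] = {w ∈ W^{⊗n}[n-2k] : e w = 0}`. -/
def sing (n k : ℕ) : Submodule ℂ (WT n) :=
  weight n k ⊓ LinearMap.ker (opE n)

/-- `b_ℓ = (-1)^{k-ℓ} (k-ℓ-1)! (n-2k+ℓ+1)! / (n-k+1)!`. -/
def bCoef (n k ℓ : ℕ) : ℂ :=
  (-1) ^ (k - ℓ) * ((k - ℓ - 1).factorial : ℂ) * ((n - 2 * k + ℓ + 1).factorial : ℂ) /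
    ((n - k + 1).factorial : ℂ)

/-- `a_ℓ = (-1)^{k+ℓ} (n-2k+1) (k-ℓ)! (n-2k+ℓ)! / (n-k+1)!`. -/
def aCoef (n k ℓ : ℕ) : ℂ :=
  (-1) ^ (k + ℓ) * ((n - 2 * k + 1 : ℕ) : ℂ) * ((k - ℓ).factorial : ℂ) *
    ((n - 2 * k + ℓ).factorial : ℂ) / ((n - k + 1).factorial : ℂ)

/-- Double counting of the pairs `M ⊂ J` of subsets with `|J| = |M| + 1`. -/
theorem sum_erase_eq_sum_insert {n : ℕ} (F : Finset (Fin n) → Finset (Fin n) → ℂ) :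
    ∑ J, ∑ i ∈ J, F (J.erase i) J = ∑ M, ∑ i ∈ Mᶜ, F M (insert i M) := by
  rw [Finset.sum_sigma', Finset.sum_sigma']
  refine Finset.sum_bij' (fun p _ => ⟨p.1.erase p.2, p.2⟩) (fun p _ => ⟨insert p.2 p.1, p.2⟩)
    ?_ ?_ ?_ ?_ ?_
  · simp
  · simp
  · rintro ⟨J, i⟩ h
    have hi : i ∈ J := by simpa using h
    simp [Finset.insert_erase hi]
  · rintro ⟨M, i⟩ h
    have hi : i ∉ M := by simpa using h
    simp [Finset.erase_insert hi]
  · rintro ⟨J, i⟩ h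
    have hi : i ∈ J := by simpa using h
    simp [Finset.insert_erase hi]

theorem opE_apply {n : ℕ} (x : WT n) (M : Finset (Fin n)) :
    opE n x M = ∑ i ∈ Mᶜ, x (insert i M) := by
  classical
  have h : opE n x M = ∑ J, ∑ i ∈ J, if J.erase i = M then x J else 0 := by
    rw [opE, mkOp, Finsupp.lsum_apply, Finsupp.sum_fintype _ _ (by simp)]
    simp [Finsupp.finsetSum_apply, Finsupp.single_apply, Finset.sum_ite, mul_comm]
  rw [h, sum_erase_eq_sum_insert fun N J => if N = M then x J else 0]
  rw [Finset.sum_eq_single M]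
  · simp
  · intro N _ hN
    simp [hN]
  · simp

theorem shap_eq_sum {n : ℕ} (x y : WT n) : shap x y = ∑ J, x J * y J := by
  rw [shap, Finsupp.sum_fintype _ _ (by simp)]

theorem apply_eq_zero_of_mem_weight {n k : ℕ} {x : WT n} (hx : x ∈ weight n k)
    {J : Finset (Fin n)} (hJ : J.card ≠ k) : x J = 0 := by
  induction hx using Submodule.span_induction with
  | mem x h =>
    obtain ⟨I, hI, rfl⟩ := h
    rw [Finsupp.single_apply, if_neg]
    rintro rfl
    exact hJ hI
  | zero => rfl
  | add x y _ _ hx hy => simp [hx, hy]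
  | smul c x _ hx => simp [hx]

theorem single_mem_weight {n k : ℕ} {I : Finset (Fin n)} (hI : I.card = k) :
    (Finsupp.single I 1 : WT n) ∈ weight n k :=
  Submodule.subset_span ⟨I, hI, rfl⟩

/-- The vector `∑_{|J|=k} a_{|I∩J|} V_J`. -/
def projVec (n k : ℕ) (I : Finset (Fin n)) : WT n :=
  ∑ J ∈ Finset.univ.filter (fun J : Finset (Fin n) => J.card = k),
    aCoef n k (I ∩ J).card • Finsupp.single J 1

theorem projVec_apply (n k : ℕ) (I J : Finset (Fin n)) :
    projVec n k I J = if J.card = k then aCoef n k (I ∩ J).card else 0 := by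
  classical
  simp [projVec, Finsupp.finsetSum_apply, Finsupp.single_apply]

theorem aCoef_recurrence {n k m : ℕ} (hn : 2 * k ≤ n) (hm : m < k) :
    ((k - m : ℕ) : ℂ) * aCoef n k (m + 1) + ((n - 2 * k + 1 + m : ℕ) : ℂ) * aCoef n k m = 0 := by
  obtain ⟨p, rfl⟩ := Nat.exists_eq_add_of_le hn
  obtain ⟨r, rfl⟩ := Nat.exists_eq_add_of_lt hm
  have h₁ : m + r + 1 - m = r + 1 := by omega
  have h₂ : m + r + 1 - (m + 1) = r := by omega
  have h₃ : 2 * (m + r + 1) + p - 2 * (m + r + 1) = p := by omega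
  simp only [aCoef, h₁, h₂, h₃, ← add_assoc p m 1, Nat.factorial_succ]
  push_cast
  ring

theorem aCoef_self {n k : ℕ} (hk : 1 ≤ k) (hn : 2 * k ≤ n) :
    aCoef n k k = 1 + (k : ℂ) * bCoef n k (k - 1) := by
  obtain ⟨p, rfl⟩ := Nat.exists_eq_add_of_le hn
  obtain ⟨r, rfl⟩ := Nat.exists_eq_add_of_le' hk
  have h₁ : r + 1 - r = 1 := by omega
  have h₂ : 2 * (r + 1) + p - (r + 1) + 1 = p + r + 1 + 1 := by omega
  have h₃ : 2 * (r + 1) + p - 2 * (r + 1) = p := by omega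
  have h₄ : (((p + r + 1).factorial : ℕ) : ℂ) ≠ 0 := by exact_mod_cast Nat.factorial_ne_zero _
  have h₅ : ((p : ℂ) + r + 1 + 1) ≠ 0 := by exact_mod_cast Nat.succ_ne_zero (p + r + 1)
  simp only [aCoef, bCoef, Nat.add_sub_cancel, h₁, h₂, h₃, ← add_assoc p r 1, Nat.sub_self,
    Nat.factorial_succ (p + r + 1), Even.neg_one_pow (Even.add_self (r + 1))]
  push_cast
  field_simp
  simp
  ring

theorem aCoef_eq_bCoef {n k l : ℕ} (hn : 2 * k ≤ n) (hl : l < k) :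
    aCoef n k l = (l : ℂ) * bCoef n k (l - 1) + ((k - l : ℕ) : ℂ) * bCoef n k l := by
  obtain ⟨p, rfl⟩ := Nat.exists_eq_add_of_le hn
  obtain ⟨r, rfl⟩ := Nat.exists_eq_add_of_lt hl
  have h₁ : l + r + 1 - l = r + 1 := by omega
  have h₃ : 2 * (l + r + 1) + p - 2 * (l + r + 1) = p := by omega
  have h₄ : ((-1 : ℂ)) ^ (l + r + 1 + l) = (-1) ^ (r + 1) := by
    rw [show l + r + 1 + l = 2 * l + (r + 1) by ring, pow_add, pow_mul]
    simp
  rcases l with _ | m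
  · simp only [aCoef, bCoef, h₁, h₃, h₄, Nat.add_sub_cancel, Nat.factorial_succ, add_zero]
    push_cast
    ring
  · have h₂ : m + 1 + r + 1 - m = r + 2 := by omega
    simp only [aCoef, bCoef, h₁, h₂, h₃, h₄, Nat.add_sub_cancel, Nat.factorial_succ,
      ← add_assoc p m 1, show r + 2 - 1 = r + 1 by omega]
    push_cast
    ring

theorem projVec_mem_sing {n k : ℕ} (hn : 2 * k ≤ n) {I : Finset (Fin n)} (hI : I.card = k) :
    projVec n k I ∈ sing n k := by
  classical
  refine ⟨Submodule.sum_mem _ fun J hJ => Submodule.smul_mem _ _ (single_mem_weight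
    (Finset.mem_filter.mp hJ).2), ?_⟩
  rw [SetLike.mem_coe, LinearMap.mem_ker]
  ext M
  rw [opE_apply, Finsupp.zero_apply]
  by_cases hM : M.card + 1 = k
  · have hlt : (I ∩ M).card < k := by
      have := Finset.card_le_card (Finset.inter_subset_right : I ∩ M ⊆ M)
      omega
    have hterm : ∀ i ∈ Mᶜ, projVec n k I (insert i M) =
        if i ∈ I then aCoef n k ((I ∩ M).card + 1) else aCoef n k (I ∩ M).card := by
      intro i hi
      have hi : i ∉ M := by simpa using hi
      rw [projVec_apply, Finset.card_insert_of_notMem hi, if_pos hM]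
      split_ifs with h
      · rw [Finset.inter_insert_of_mem h, Finset.card_insert_of_notMem (by simp [hi])]
      · rw [Finset.inter_insert_of_notMem h]
    have hin : (Mᶜ.filter (· ∈ I)).card = k - (I ∩ M).card := by
      rw [show Mᶜ.filter (· ∈ I) = I \ M by ext; simp [and_comm], Finset.card_sdiff,
        Finset.inter_comm, hI]
    have hout : (Mᶜ.filter (· ∉ I)).card = n - 2 * k + 1 + (I ∩ M).card := by
      have h := Finset.card_filter_add_card_filter_not (s := Mᶜ) (· ∈ I)
      rw [hin, Finset.card_compl, Fintype.card_fin] at h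
      omega
    rw [Finset.sum_congr rfl hterm, Finset.sum_ite, Finset.sum_const, Finset.sum_const, hin, hout,
      nsmul_eq_mul, nsmul_eq_mul, aCoef_recurrence hn hlt]
  · refine Finset.sum_eq_zero fun i hi => ?_
    rw [projVec_apply, Finset.card_insert_of_notMem (by simpa using hi), if_neg hM]

/-- The coefficient of `V_J` in `∑_{|J|=k} a_{|I∩J|} V_J - V_I` is that of
`f (∑_{|M|=k-1} b_{|I∩M|} V_M)`. -/
theorem aCoef_eq_sum_bCoef {n k : ℕ} (hk : 1 ≤ k) (hn : 2 * k ≤ n) {I J : Finset (Fin n)}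
    (hI : I.card = k) (hJ : J.card = k) :
    aCoef n k (I ∩ J).card =
      (if I = J then 1 else 0) + ∑ i ∈ J, bCoef n k (I ∩ J.erase i).card := by
  classical
  have hterm : ∀ i ∈ J, bCoef n k (I ∩ J.erase i).card =
      if i ∈ I then bCoef n k ((I ∩ J).card - 1) else bCoef n k (I ∩ J).card := by
    intro i hi
    rw [Finset.inter_erase]
    split_ifs with h
    · rw [Finset.card_erase_of_mem (by simp [h, hi])]
    · rw [Finset.erase_eq_of_notMem (by simp [h])]
  have hin : (J.filter (· ∈ I)).card = (I ∩ J).card := by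
    rw [Finset.filter_mem_eq_inter, Finset.inter_comm]
  have hout : (J.filter (· ∉ I)).card = k - (I ∩ J).card := by
    have h := Finset.card_filter_add_card_filter_not (s := J) (· ∈ I)
    omega
  rw [Finset.sum_congr rfl hterm, Finset.sum_ite, Finset.sum_const, Finset.sum_const, hin, hout,
    nsmul_eq_mul, nsmul_eq_mul]
  split_ifs with h
  · subst h
    simp [hI, aCoef_self hk hn]
  · have hlt : (I ∩ J).card < k := by
      refine lt_of_le_of_ne (hI ▸ Finset.card_le_card Finset.inter_subset_left) fun hc => h ?_
      have h₁ := Finset.eq_of_subset_of_card_le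
        (Finset.inter_subset_left : I ∩ J ⊆ I) (by omega)
      have h₂ := Finset.eq_of_subset_of_card_le
        (Finset.inter_subset_right : I ∩ J ⊆ J) (by omega)
      exact h₁.symm.trans h₂
    rw [zero_add, aCoef_eq_bCoef hn hlt]

/-- `∑_{|J|=k} a_{|I∩J|} V_J` represents evaluation at `I` on singular vectors. -/
theorem sum_projVec_mul {n k : ℕ} (hk : 1 ≤ k) (hn : 2 * k ≤ n) {I : Finset (Fin n)}
    (hI : I.card = k) {s : WT n} (hs : s ∈ sing n k) :
    ∑ J, projVec n k I J * s J = s I := by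
  classical
  have hterm : ∀ J, projVec n k I J * s J =
      (if I = J then s J else 0) + ∑ i ∈ J, bCoef n k (I ∩ J.erase i).card * s J := by
    intro J
    by_cases hJ : J.card = k
    · rw [projVec_apply, if_pos hJ, aCoef_eq_sum_bCoef hk hn hI hJ, add_mul, Finset.sum_mul]
      simp
    · simp [apply_eq_zero_of_mem_weight hs.1 hJ]
  have hE : ∀ M, ∑ i ∈ Mᶜ, s (insert i M) = 0 := by
    intro M
    rw [← opE_apply, LinearMap.mem_ker.mp hs.2, Finsupp.zero_apply]
  rw [Finset.sum_congr rfl fun J _ => hterm J, Finset.sum_add_distrib,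
    sum_erase_eq_sum_insert fun M J => bCoef n k (I ∩ M).card * s J]
  simp [← Finset.mul_sum, hE]

/-- for a `k`-element subset `I`, the orthogonal projection
`v_I = π(V_I)` expanded in the basis `{V_J : |J| = k}` is
`v_I = ∑_{|J|=k} a_{|I∩J|} V_J`. -/
theorem stmt1 (n k : ℕ) (hk : 1 ≤ k) (hn : 2 * k ≤ n)
    (π : WT n →ₗ[ℂ] WT n)
    (hrange : ∀ x ∈ weight n k, π x ∈ sing n k)
    (hfix : ∀ x ∈ sing n k, π x = x)
    (horth : ∀ x ∈ weight n k, ∀ s ∈ sing n k, shap (x - π x) s = 0)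
    (I : Finset (Fin n)) (hI : I.card = k) :
    π (Finsupp.single I 1) =
      ∑ J ∈ Finset.univ.filter (fun J : Finset (Fin n) => J.card = k),
        aCoef n k (I ∩ J).card • Finsupp.single J 1 := by
  classical
  change _ = projVec n k I
  have hw := single_mem_weight hI
  have hπ := hrange _ hw
  ext K
  by_cases hK : K.card = k
  · have hu := projVec_mem_sing hn hK
    have h := horth _ hw _ hu
    have hsymm : projVec n k K I = projVec n k I K := by
      rw [projVec_apply, projVec_apply, if_pos hI, if_pos hK, Finset.inter_comm]
    have hev := sum_projVec_mul hk hn hK hπ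
    simp only [shap_eq_sum, Finsupp.sub_apply, sub_mul, Finset.sum_sub_distrib, sub_eq_zero,
      Finsupp.single_apply, ite_mul, one_mul, zero_mul, Finset.sum_ite_eq, Finset.mem_univ,
      if_true] at h
    rw [← hev, ← hsymm, h]
    exact Finset.sum_congr rfl fun J _ => mul_comm _ _
  · rw [apply_eq_zero_of_mem_weight hπ.1 hK, projVec_apply, if_neg hK]
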